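/- arXiv:1906.02988 — 3 statements merged into one kernel-verified Lean document; each statement's English description precedes it below -/
import Mathlib

section
/- Let X be a connected, locally compact metric space. Then the isometry group Iso(X), equipped with the compact-open topology, is locally compact. -/
open Filter Topology in
theorem iso_step {X ι : Type*} [MetricSpace X] (F : Ultrafilter ι) (φ : ι → (X ≃ᵢ X))
    {x a : X} {ε : ℝ} (hc : IsCompact (Metric.closedBall x (4 * ε)))
    (hxa : dist x a < ε) (ha : ∃ y, Tendsto (fun i => φ i a) F (𝓝 y)) :
    ∃ y, Tendsto (fun i => φ i x) F (𝓝 y) := by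
  obtain ⟨y, hy⟩ := ha
  have hε : 0 < ε := dist_nonneg.trans_lt hxa
  have hev : ∀ᶠ i in (F : Filter ι), dist (φ i a) y < ε := Metric.tendsto_nhds.1 hy ε hε
  obtain ⟨i0, hi0⟩ := hev.exists
  have hK : IsCompact ((φ i0) '' Metric.closedBall x (4 * ε)) := hc.image (φ i0).continuous
  rw [IsometryEquiv.image_closedBall] at hK
  have hmem : ∀ᶠ i in (F : Filter ι), φ i x ∈ Metric.closedBall (φ i0 x) (4 * ε) := by
    filter_upwards [hev] with i hi
    rw [Metric.mem_closedBall]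
    have h1 := (φ i).isometry.dist_eq x a
    have h2 := (φ i0).isometry.dist_eq x a
    have h3 := dist_triangle (φ i x) (φ i a) (φ i0 x)
    have h4 := dist_triangle (φ i a) y (φ i0 x)
    have h5 := dist_triangle y (φ i0 a) (φ i0 x)
    rw [dist_comm y (φ i0 a), dist_comm (φ i0 a) (φ i0 x)] at h5
    linarith
  obtain ⟨z, -, hz⟩ := hK.ultrafilter_le_nhds (F.map fun i => φ i x) (by
    rw [le_principal_iff]; exact hmem)
  exact ⟨z, hz⟩

open Filter Topology in
theorem iso_all {X ι : Type*} [MetricSpace X] [ConnectedSpace X] [LocallyCompactSpace X]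
    (F : Ultrafilter ι) (φ : ι → (X ≃ᵢ X)) (x0 : X)
    (h0 : ∃ y, Tendsto (fun i => φ i x0) F (𝓝 y)) (x : X) :
    ∃ y, Tendsto (fun i => φ i x) F (𝓝 y) := by
  have hball : ∀ x : X, ∃ r > 0, IsCompact (Metric.closedBall x r) := fun x => by
    obtain ⟨K, hK, hx⟩ := exists_compact_mem_nhds x
    obtain ⟨r, hr, hs⟩ := Metric.nhds_basis_closedBall.mem_iff.1 hx
    exact ⟨r, hr, hK.of_isClosed_subset Metric.isClosed_closedBall hs⟩
  have hcl : IsClopen {x : X | ∃ y, Tendsto (fun i => φ i x) F (𝓝 y)} := by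
    constructor
    · refine isClosed_of_closure_subset fun x hx => ?_
      obtain ⟨r, hr, hc⟩ := hball x
      obtain ⟨a, ha, hd⟩ := Metric.mem_closure_iff.1 hx (r / 4) (by positivity)
      exact iso_step F φ (ε := r / 4) (by convert hc using 2; ring) hd ha
    · refine Metric.isOpen_iff.2 fun a ha => ?_
      obtain ⟨r, hr, hc⟩ := hball a
      refine ⟨r / 8, by positivity, fun x hx => ?_⟩
      rw [Metric.mem_ball] at hx
      refine iso_step F φ (ε := r / 8) ?_ hx ha
      refine hc.of_isClosed_subset Metric.isClosed_closedBall
        (Metric.closedBall_subset_closedBall' ?_)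
      linarith
  have := hcl.eq_univ ⟨x0, h0⟩
  exact Set.eq_univ_iff_forall.1 this x

open Filter Topology in
/-- If `X` is a connected, locally compact metric space, then the
isometry group `Iso(X) = X ≃ᵢ X`, equipped with the compact-open topology, is
locally compact. -/
theorem isometryGroup_locallyCompact {X : Type*} [MetricSpace X]
    [ConnectedSpace X] [LocallyCompactSpace X] :
    letI : TopologicalSpace (X ≃ᵢ X) :=
      TopologicalSpace.induced
        (fun f : X ≃ᵢ X => (⟨f, f.continuous⟩ : C(X, X)))
        ContinuousMap.compactOpen
    LocallyCompactSpace (X ≃ᵢ X) := by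
  letI : TopologicalSpace (X ≃ᵢ X) :=
      TopologicalSpace.induced
        (fun f : X ≃ᵢ X => (⟨f, f.continuous⟩ : C(X, X)))
        ContinuousMap.compactOpen
  show LocallyCompactSpace (X ≃ᵢ X)
  have hind : IsInducing (fun f : X ≃ᵢ X => (⟨f, f.continuous⟩ : C(X, X))) := ⟨rfl⟩
  have hinj : Function.Injective (fun f : X ≃ᵢ X => (⟨f, f.continuous⟩ : C(X, X))) := by
    intro f g h
    ext x
    exact congrArg (fun k : C(X, X) => k x) h
  haveI : T2Space (X ≃ᵢ X) := (IsEmbedding.mk hind hinj).t2Space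
  have heval : ∀ x : X, Continuous (fun f : X ≃ᵢ X => f x) := fun x =>
    (continuous_eval_const (F := C(X, X)) x).comp hind.continuous
  suffices WeaklyLocallyCompactSpace (X ≃ᵢ X) from inferInstance
  refine ⟨fun f => ?_⟩
  obtain ⟨x0⟩ : Nonempty X := inferInstance
  obtain ⟨r, hr, hc⟩ : ∃ r > 0, IsCompact (Metric.closedBall x0 r) := by
    obtain ⟨K, hK, hx⟩ := exists_compact_mem_nhds x0
    obtain ⟨r, hr, hs⟩ := Metric.nhds_basis_closedBall.mem_iff.1 hx
    exact ⟨r, hr, hK.of_isClosed_subset Metric.isClosed_closedBall hs⟩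
  have hc' : IsCompact (Metric.closedBall (f x0) r) := by
    rw [← IsometryEquiv.image_closedBall]
    exact hc.image f.continuous
  refine ⟨(fun h : X ≃ᵢ X => h x0) ⁻¹' Metric.closedBall (f x0) r, ?_,
    (heval x0).continuousAt.preimage_mem_nhds (Metric.closedBall_mem_nhds _ hr)⟩
  rw [isCompact_iff_ultrafilter_le_nhds]
  intro F hF
  rw [le_principal_iff] at hF
  have hF1 : ∀ᶠ h in (F : Filter (X ≃ᵢ X)), h x0 ∈ Metric.closedBall (f x0) r := hF
  have hF2 : ∀ᶠ h in (F : Filter (X ≃ᵢ X)), h.symm (f x0) ∈ Metric.closedBall x0 r := by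
    filter_upwards [hF1] with h hh
    rw [Metric.mem_closedBall] at hh ⊢
    rw [← h.isometry.dist_eq, h.apply_symm_apply, dist_comm]
    exact hh
  have A := iso_all F (fun h => h) x0 (by
    obtain ⟨z, -, hz⟩ := hc'.ultrafilter_le_nhds (F.map fun h => h x0) (by
      rw [le_principal_iff]; exact hF1)
    exact ⟨z, hz⟩)
  have B := iso_all F (fun h => h.symm) (f x0) (by
    obtain ⟨z, -, hz⟩ := hc.ultrafilter_le_nhds (F.map fun h => h.symm (f x0)) (by
      rw [le_principal_iff]; exact hF2)
    exact ⟨z, hz⟩)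
  choose g hg using A
  choose k hk using B
  have hiso : Isometry g := Isometry.of_dist_eq fun x y => by
    refine tendsto_nhds_unique ((hg x).dist (hg y)) ?_
    simp only [IsometryEquiv.dist_eq]
    exact tendsto_const_nhds
  have hgk : ∀ x, g (k x) = x := fun x => by
    have h1 : Tendsto (fun h : X ≃ᵢ X => dist (h (k x)) x) F (𝓝 (dist (g (k x)) x)) :=
      (hg (k x)).dist tendsto_const_nhds
    have h2 : Tendsto (fun h : X ≃ᵢ X => dist (h (k x)) x) F (𝓝 0) := by
      have : Tendsto (fun h : X ≃ᵢ X => dist (k x) (h.symm x)) F (𝓝 (dist (k x) (k x))) :=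
        tendsto_const_nhds.dist (hk x)
      rw [dist_self] at this
      refine this.congr fun h => ?_
      rw [← h.isometry.dist_eq, h.apply_symm_apply]
    exact dist_eq_zero.1 (tendsto_nhds_unique h1 h2)
  let G : X ≃ᵢ X := IsometryEquiv.mk' g k hgk hiso
  have hG : ∀ x, G x = g x := fun x => rfl
  refine ⟨G, ?_, ?_⟩
  · exact Metric.isClosed_closedBall.mem_of_tendsto (hg x0) hF1
  · rw [hind.nhds_eq_comap, ← tendsto_iff_comap]
    apply ContinuousMap.tendsto_of_tendstoLocallyUniformly
    rw [Metric.tendstoLocallyUniformly_iff]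
    intro ε hε x
    refine ⟨Metric.ball x (ε / 3), Metric.ball_mem_nhds _ (by positivity), ?_⟩
    filter_upwards [Metric.tendsto_nhds.1 (hg x) (ε / 3) (by positivity)] with h hh y hy
    rw [Metric.mem_ball] at hy
    show dist (g y) (h y) < ε
    have h1 := hiso.dist_eq y x
    have h2 := h.isometry.dist_eq y x
    have h3 := dist_triangle (g y) (g x) (h y)
    have h4 := dist_triangle (g x) (h x) (h y)
    rw [dist_comm (g x) (h x), dist_comm (h x) (h y)] at h4
    linarith
end

section
/- Let X be a connected, locally compact metric space. Then the action of Iso(X) (with the compact-open topology) on X is proper, i.e. the map Iso(X) × X → X × X, (f,x) ↦ (f(x), x), is a proper map. -/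
open Filter Topology

theorem aux_conv {X ι : Type*} [MetricSpace X] [ConnectedSpace X] [LocallyCompactSpace X]
    (U : Ultrafilter ι) (F : ι → X ≃ᵢ X) (x0 y0 : X)
    (h0 : Tendsto (fun i => F i x0) U (𝓝 y0)) (x : X) :
    ∃ y, Tendsto (fun i => F i x) U (𝓝 y) := by
  have key : ∀ (z w x : X) (r : ℝ), Tendsto (fun i => F i z) U (𝓝 w) →
      IsCompact (Metric.closedBall w r) → dist x z < r →
      ∃ y, Tendsto (fun i => F i x) U (𝓝 y) := by
    intro z w x r hz hK hx
    have h1 : ∀ᶠ i in (U : Filter ι), F i x ∈ Metric.closedBall w r := by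
      have := (Metric.tendsto_nhds.1 hz) (r - dist x z) (by linarith)
      filter_upwards [this] with i hi
      have h2 := dist_triangle (F i x) (F i z) w
      rw [(F i).isometry.dist_eq] at h2
      rw [Metric.mem_closedBall]
      linarith
    obtain ⟨y, -, hy⟩ := hK.ultrafilter_le_nhds (U.map (fun i => F i x))
      (by rw [le_principal_iff]; exact h1)
    exact ⟨y, hy⟩
  have hclopen : IsClopen {x : X | ∃ y, Tendsto (fun i => F i x) U (𝓝 y)} := by
    constructor
    · rw [← closure_subset_iff_isClosed]
      intro x hx
      obtain ⟨r, hr, hK⟩ := Metric.exists_isCompact_closedBall x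
      obtain ⟨z, ⟨w, hw⟩, hz⟩ := Metric.mem_closure_iff.1 hx (r / 4) (by linarith)
      obtain ⟨i, hi⟩ := ((Metric.tendsto_nhds.1 hw) (r / 4) (by linarith)).exists
      refine key z w x (r / 4) hw ?_ hz
      have hc : IsCompact (F i '' Metric.closedBall x r) := hK.image (F i).continuous
      rw [(F i).image_closedBall] at hc
      refine hc.of_isClosed_subset Metric.isClosed_closedBall ?_
      apply Metric.closedBall_subset_closedBall'
      have h2 := dist_triangle w (F i z) (F i x)
      rw [(F i).isometry.dist_eq, dist_comm z x, dist_comm w (F i z)] at h2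
      linarith
    · rw [Metric.isOpen_iff]
      rintro z ⟨w, hw⟩
      obtain ⟨r, hr, hK⟩ := Metric.exists_isCompact_closedBall w
      exact ⟨r, hr, fun x hx => key z w x r hw hK hx⟩
  have := hclopen.eq_univ ⟨x0, y0, h0⟩
  exact (this ▸ Set.mem_univ x : x ∈ {x : X | ∃ y, Tendsto (fun i => F i x) U (𝓝 y)})

theorem aux_lim {X ι : Type*} [MetricSpace X] [ConnectedSpace X] [LocallyCompactSpace X]
    (U : Ultrafilter ι) (F : ι → X ≃ᵢ X) (x0 y0 : X)
    (h0 : Tendsto (fun i => F i x0) U (𝓝 y0)) :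
    ∃ g : X ≃ᵢ X, ∀ x, Tendsto (fun i => F i x) U (𝓝 (g x)) := by
  have h0' : Tendsto (fun i => (F i).symm y0) U (𝓝 x0) := by
    rw [tendsto_iff_dist_tendsto_zero] at h0 ⊢
    refine h0.congr fun i => ?_
    rw [← (F i).isometry.dist_eq ((F i).symm y0), (F i).apply_symm_apply, dist_comm]
  choose g hg using aux_conv U F x0 y0 h0
  choose h hh using aux_conv U (fun i => (F i).symm) y0 x0 h0'
  have iso : Isometry g := by
    refine Isometry.of_dist_eq fun x y => ?_
    refine tendsto_nhds_unique ((hg x).dist (hg y)) ?_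
    simp only [(F _).isometry.dist_eq]
    exact tendsto_const_nhds
  have inv : ∀ y, g (h y) = y := by
    intro y
    refine tendsto_nhds_unique (hg (h y)) ?_
    have := hh y
    rw [tendsto_iff_dist_tendsto_zero] at this ⊢
    refine this.congr fun i => ?_
    rw [← (F i).isometry.dist_eq, (F i).apply_symm_apply, dist_comm]
  exact ⟨IsometryEquiv.mk' g h inv iso, hg⟩

/-- If `X` is a connected, locally compact metric space, then the
action of the isometry group `Iso(X) = X ≃ᵢ X` (with the compact-open topology)
on `X` is proper: the map `Iso(X) × X → X × X`, `(f, x) ↦ (f x, x)`, is a proper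
map. -/
theorem isometryGroup_properAction {X : Type*} [MetricSpace X]
    [ConnectedSpace X] [LocallyCompactSpace X] :
    letI : TopologicalSpace (X ≃ᵢ X) :=
      TopologicalSpace.induced
        (fun f : X ≃ᵢ X => (⟨f, f.continuous⟩ : C(X, X)))
        ContinuousMap.compactOpen
    IsProperMap (fun p : (X ≃ᵢ X) × X => (p.1 p.2, p.2)) := by
  letI : TopologicalSpace (X ≃ᵢ X) :=
      TopologicalSpace.induced
        (fun f : X ≃ᵢ X => (⟨f, f.continuous⟩ : C(X, X)))
        ContinuousMap.compactOpen
  have hind : IsInducing (fun f : X ≃ᵢ X => (⟨f, f.continuous⟩ : C(X, X))) := ⟨rfl⟩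
  change IsProperMap (fun p : (X ≃ᵢ X) × X => (p.1 p.2, p.2))
  rw [isProperMap_iff_ultrafilter]
  constructor
  · refine Continuous.prodMk ?_ continuous_snd
    have h1 : Continuous fun p : (X ≃ᵢ X) × X =>
        ((⟨p.1, p.1.continuous⟩ : C(X, X)), p.2) :=
      (hind.continuous.comp continuous_fst).prodMk continuous_snd
    exact (ContinuousEval.continuous_eval (F := C(X, X))).comp h1
  · rintro U ⟨y0, x0⟩ hU
    have hy : Tendsto (fun p : (X ≃ᵢ X) × X => p.1 p.2) U (𝓝 y0) :=
      (continuous_fst.tendsto (y0, x0)).comp hU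
    have hx : Tendsto (fun p : (X ≃ᵢ X) × X => p.2) U (𝓝 x0) :=
      (continuous_snd.tendsto (y0, x0)).comp hU
    have h0 : Tendsto (fun p : (X ≃ᵢ X) × X => p.1 x0) U (𝓝 y0) := by
      refine hy.congr_dist ?_
      simp only [fun p : (X ≃ᵢ X) × X => p.1.isometry.dist_eq p.2 x0]
      exact tendsto_iff_dist_tendsto_zero.1 hx
    obtain ⟨g, hg⟩ := aux_lim U (fun p => p.1) x0 y0 h0
    refine ⟨(g, x0), ?_, ?_⟩
    · exact Prod.ext (tendsto_nhds_unique (hg x0) h0) rfl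
    · have hG : Tendsto (fun p : (X ≃ᵢ X) × X => p.1) U (𝓝 g) := by
        rw [hind.tendsto_nhds_iff, ContinuousMap.tendsto_iff_tendstoLocallyUniformly,
          Metric.tendstoLocallyUniformly_iff]
        intro ε hε x
        refine ⟨Metric.ball x (ε / 3), Metric.ball_mem_nhds x (by linarith), ?_⟩
        filter_upwards [(Metric.tendsto_nhds.1 (hg x)) (ε / 3) (by linarith)] with p hp y hy
        change dist (g y) (p.1 y) < ε
        have h1 := dist_triangle4 (g y) (g x) (p.1 x) (p.1 y)
        rw [g.isometry.dist_eq, p.1.isometry.dist_eq, dist_comm x y, dist_comm (g x)] at h1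
        rw [Metric.mem_ball] at hy
        linarith
      exact hG.prodMk_nhds hx
end

section
/- Let X be a connected, locally compact metric space. Then for every x ∈ X the isotropy subgroup {f ∈ Iso(X) : f(x) = x} is compact in the compact-open topology. -/
open Filter Topology in
theorem iso_aux_conv {X : Type*} [MetricSpace X]
    [ConnectedSpace X] [LocallyCompactSpace X] (U : Ultrafilter (X ≃ᵢ X)) (x : X)
    (hU : ∀ᶠ f in (U : Filter (X ≃ᵢ X)), f x = x) (y : X) :
    ∃ z, Tendsto (fun f : X ≃ᵢ X => f y) U (𝓝 z) := by
  have key : ∀ (K : Set X) (y : X), IsCompact K →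
      (∀ᶠ f in (U : Filter (X ≃ᵢ X)), f y ∈ K) →
      ∃ z, Tendsto (fun f : X ≃ᵢ X => f y) U (𝓝 z) := by
    intro K y hK h
    obtain ⟨z, -, hz⟩ := isCompact_iff_ultrafilter_le_nhds.1 hK (U.map (fun f : X ≃ᵢ X => f y))
      (Filter.le_principal_iff.2 h)
    exact ⟨z, hz⟩
  have cb : ∀ z : X, ∃ r > 0, IsCompact (Metric.closedBall z r) := by
    intro z
    obtain ⟨K, hK, hz⟩ := exists_compact_mem_nhds z
    obtain ⟨r, hr, h⟩ := Metric.nhds_basis_closedBall.mem_iff.1 hz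
    exact ⟨r, hr, hK.of_isClosed_subset Metric.isClosed_closedBall h⟩
  let A : Set X := {y | ∃ z, Tendsto (fun f : X ≃ᵢ X => f y) U (𝓝 z)}
  have hA : IsClopen A := by
    constructor
    · refine isClosed_of_closure_subset fun y hy => ?_
      obtain ⟨r, hr, hc⟩ := cb y
      obtain ⟨a, ⟨z, hz⟩, ha⟩ := Metric.mem_closure_iff.1 hy (r / 4) (by positivity)
      have ev := Metric.tendsto_nhds.1 hz (r / 4) (by positivity)
      obtain ⟨f0, hf0⟩ := ev.exists
      refine key (f0 '' Metric.closedBall y r) y (hc.image f0.continuous) ?_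
      filter_upwards [ev] with f hf
      rw [IsometryEquiv.image_closedBall, Metric.mem_closedBall]
      have h1 := f.isometry.dist_eq y a
      have h2 := f0.isometry.dist_eq y a
      have h3 := dist_triangle4 (f y) (f a) z (f0 a)
      have h4 := dist_triangle (f y) (f0 a) (f0 y)
      rw [dist_comm (f0 a) (f0 y)] at h4
      rw [dist_comm z (f0 a)] at h3
      linarith
    · refine Metric.isOpen_iff.2 fun y hy => ?_
      obtain ⟨z, hz⟩ := hy
      obtain ⟨r, hr, hc⟩ := cb z
      refine ⟨r / 2, by positivity, fun y' hy' => key _ y' hc ?_⟩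
      filter_upwards [Metric.tendsto_nhds.1 hz (r / 2) (by positivity)] with f hf
      rw [Metric.mem_closedBall]
      have h1 := f.isometry.dist_eq y' y
      have h2 := dist_triangle (f y') (f y) z
      rw [Metric.mem_ball] at hy'
      linarith
  have hx : x ∈ A := ⟨x, tendsto_const_nhds.congr' (by
    filter_upwards [hU] with f hf using hf.symm)⟩
  have : A = Set.univ := hA.eq_univ ⟨x, hx⟩
  have hy : y ∈ A := this ▸ Set.mem_univ y
  exact hy

open Filter Topology in
/-- If `X` is a connected, locally compact metric space, then for
every `x ∈ X` the isotropy subgroup `{f ∈ Iso(X) : f x = x}` is compact in the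
compact-open topology on `Iso(X) = X ≃ᵢ X`. -/
theorem isometryGroup_isotropy_compact {X : Type*} [MetricSpace X]
    [ConnectedSpace X] [LocallyCompactSpace X] :
    letI : TopologicalSpace (X ≃ᵢ X) :=
      TopologicalSpace.induced
        (fun f : X ≃ᵢ X => (⟨f, f.continuous⟩ : C(X, X)))
        ContinuousMap.compactOpen
    ∀ x : X, IsCompact {f : X ≃ᵢ X | f x = x} := by
  intro x
  letI : TopologicalSpace (X ≃ᵢ X) :=
      TopologicalSpace.induced
        (fun f : X ≃ᵢ X => (⟨f, f.continuous⟩ : C(X, X)))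
        ContinuousMap.compactOpen
  refine isCompact_iff_ultrafilter_le_nhds.2 fun U hU => ?_
  have hU : ∀ᶠ f in (U : Filter (X ≃ᵢ X)), f x = x := by
    exact Filter.le_principal_iff.1 hU
  choose g hg using iso_aux_conv U x hU
  have hV : ∀ᶠ f in ((U.map IsometryEquiv.symm : Ultrafilter (X ≃ᵢ X)) : Filter (X ≃ᵢ X)),
      f x = x := by
    rw [Ultrafilter.coe_map, eventually_map]
    filter_upwards [hU] with f hf
    rw [IsometryEquiv.symm_apply_eq, hf]
  choose h hh using iso_aux_conv (U.map IsometryEquiv.symm) x hV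
  have hh' : ∀ y, Tendsto (fun f : X ≃ᵢ X => f.symm y) U (𝓝 (h y)) := fun y => by
    have := hh y
    rw [Ultrafilter.coe_map, tendsto_map'_iff] at this
    exact this
  have giso : Isometry g := Isometry.of_dist_eq fun a b =>
    tendsto_nhds_unique ((hg a).dist (hg b))
      (tendsto_const_nhds.congr fun f => (f.isometry.dist_eq a b).symm)
  have gh : ∀ y, g (h y) = y := fun y => by
    refine tendsto_nhds_unique (hg (h y)) ?_
    rw [tendsto_iff_dist_tendsto_zero]
    have h1 := (tendsto_iff_dist_tendsto_zero.1 (hh' y))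
    refine h1.congr fun f => ?_
    rw [← f.isometry.dist_eq, f.apply_symm_apply, dist_comm]
  refine ⟨IsometryEquiv.mk' g h gh giso, ?_, ?_⟩
  · exact tendsto_nhds_unique (hg x) (tendsto_const_nhds.congr' (by
      filter_upwards [hU] with f hf using hf.symm))
  · rw [nhds_induced, ← tendsto_iff_comap, ContinuousMap.tendsto_iff_tendstoLocallyUniformly,
      Metric.tendstoLocallyUniformly_iff]
    intro ε hε y
    refine ⟨Metric.ball y (ε / 3), Metric.ball_mem_nhds _ (by positivity), ?_⟩
    filter_upwards [Metric.tendsto_nhds.1 (hg y) (ε / 3) (by positivity)] with f hf y' hy'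
    change dist (g y') (f y') < ε
    have h1 := giso.dist_eq y' y
    have h2 := f.isometry.dist_eq y' y
    have h3 := dist_triangle4 (g y') (g y) (f y) (f y')
    rw [dist_comm (g y) (f y), dist_comm (f y) (f y')] at h3
    rw [Metric.mem_ball] at hy'
    linarith
end
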